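/- Let K be a quadratic number field with discriminant D, and for n ≥ 1 let r_K(n) denote the number of nonzero integral ideals of the ring of integers O_K of absolute norm n. Then for Re(s) > 1, ∑_{n=1}^∞ r_K(n³) n^{-s} = ( ζ_K(s)² / ( ζ(2s) ζ_K(2s) ) ) · G(s), where G(s) = ∏_{p | D} (1 − p^{-s}) (1 − p^{-2s})^{-2} · ∏_{p split} (1 + 2 p^{-s})(1 − p^{-s})² (1 − p^{-2s})^{-3} · ∏_{p inert} (1 − p^{-4s})^{-1}, the products running over ramified, split and inert rational primes respectively; moreover G is holomorphic and bounded on every half-plane Re(s) ≥ θ with θ > 1/3. -/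

import Mathlib

open Complex

/-- `rK K n` is the number of nonzero integral ideals of the ring of integers of `K`
of absolute norm `n`. -/
noncomputable def rK (K : Type*) [Field K] [NumberField K] (n : ℕ) : ℕ :=
  Nat.card {I : Ideal (NumberField.RingOfIntegers K) // Ideal.absNorm I = n ∧ I ≠ ⊥}

/-- A rational prime `p` splits in `K`: `p O_K = P₁ P₂` with distinct prime ideals of
norm `p`. -/
def IsSplitPrime (K : Type*) [Field K] [NumberField K] (p : ℕ) : Prop :=
  ∃ P₁ P₂ : Ideal (NumberField.RingOfIntegers K),
    P₁.IsPrime ∧ P₂.IsPrime ∧ P₁ ≠ P₂ ∧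
    Ideal.span {(p : NumberField.RingOfIntegers K)} = P₁ * P₂ ∧
    Ideal.absNorm P₁ = p ∧ Ideal.absNorm P₂ = p

/-- A rational prime `p` is inert in `K`: `p O_K` is prime of norm `p²`. -/
def IsInertPrime (K : Type*) [Field K] [NumberField K] (p : ℕ) : Prop :=
  (Ideal.span {(p : NumberField.RingOfIntegers K)}).IsPrime ∧
    Ideal.absNorm (Ideal.span {(p : NumberField.RingOfIntegers K)}) = p ^ 2


theorem absNorm_span_natCast_of_finrank_two {K : Type*} [Field K] [NumberField K]
    (hK2 : Module.finrank ℚ K = 2) (n : ℕ) :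
    Ideal.absNorm (Ideal.span {(n : NumberField.RingOfIntegers K)}) = n ^ 2 := by
  rw [Ideal.absNorm_span_natCast, NumberField.RingOfIntegers.rank, hK2]

theorem dvd_span_natCast_of_absNorm_eq {K : Type*} [Field K] [NumberField K] {n : ℕ}
    {I : Ideal (NumberField.RingOfIntegers K)} (hI : Ideal.absNorm I = n) :
    I ∣ Ideal.span {(n : NumberField.RingOfIntegers K)} := by
  rw [Ideal.dvd_iff_le, ← hI]
  exact Ideal.span_singleton_absNorm_le I

theorem dvd_span_natCast_pow_of_absNorm_eq {K : Type*} [Field K] [NumberField K] {p k : ℕ}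
    {I : Ideal (NumberField.RingOfIntegers K)} (hI : Ideal.absNorm I = p ^ k) :
    I ∣ Ideal.span {(p : NumberField.RingOfIntegers K)} ^ k := by
  simpa [Ideal.span_singleton_pow] using dvd_span_natCast_of_absNorm_eq hI

/-- A rational prime `p` ramifies in `K`: `p O_K = P²` with `P` prime of norm `p`. -/
def IsRamifiedPrime (K : Type*) [Field K] [NumberField K] (p : ℕ) : Prop :=
  ∃ P : Ideal (NumberField.RingOfIntegers K), P.IsPrime ∧
    Ideal.span {(p : NumberField.RingOfIntegers K)} = P ^ 2 ∧ Ideal.absNorm P = p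

theorem Ideal.isPrime_of_absNorm_eq_prime {K : Type*} [Field K] [NumberField K] {p : ℕ}
    (hp : p.Prime) {P : Ideal (NumberField.RingOfIntegers K)} (hP : Ideal.absNorm P = p) :
    P.IsPrime :=
  Ideal.isPrime_of_irreducible_absNorm (hP ▸ hp)

/-- A prime ideal containing the rational prime `p` to order at least two makes `p` ramified. -/
theorem isRamifiedPrime_of_sq_dvd {K : Type*} [Field K] [NumberField K]
    (hK2 : Module.finrank ℚ K = 2) {p : ℕ} (hp : p.Prime)
    {P : Ideal (NumberField.RingOfIntegers K)} (hP : P.IsPrime)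
    (h : P ^ 2 ∣ Ideal.span {(p : NumberField.RingOfIntegers K)}) : IsRamifiedPrime K p := by
  obtain ⟨Q, hQ⟩ := h
  have hN := congrArg Ideal.absNorm hQ
  rw [absNorm_span_natCast_of_finrank_two hK2, map_mul, map_pow] at hN
  have hdvd : Ideal.absNorm P ∣ p := (Nat.pow_dvd_pow_iff two_ne_zero).1 ⟨_, hN⟩
  have hP1 : Ideal.absNorm P ≠ 1 := fun h => hP.ne_top (Ideal.absNorm_eq_one_iff.1 h)
  have hPp : Ideal.absNorm P = p := ((Nat.dvd_prime hp).1 hdvd).resolve_left hP1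
  have hQ1 : Ideal.absNorm Q = 1 := by
    rw [hPp] at hN
    exact (mul_eq_left₀ (pow_ne_zero 2 hp.ne_zero)).1 hN.symm
  rw [Ideal.absNorm_eq_one_iff.1 hQ1, Ideal.mul_top] at hQ
  exact ⟨P, hP, hQ, hPp⟩

theorem isRamified_or_isSplit_or_isInert {K : Type*} [Field K] [NumberField K]
    (hK2 : Module.finrank ℚ K = 2) {p : ℕ} (hp : p.Prime) :
    IsRamifiedPrime K p ∨ IsSplitPrime K p ∨ IsInertPrime K p := by
  have hN := absNorm_span_natCast_of_finrank_two hK2 p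
  obtain ⟨P, hPmax, -, Q, hQ⟩ := Ideal.exists_isMaximal_dvd_of_dvd_absNorm' hp
    (Ideal.span {(p : NumberField.RingOfIntegers K)}) (hN ▸ dvd_pow_self p two_ne_zero)
  have hPQ : Ideal.absNorm P * Ideal.absNorm Q = p ^ 2 := by rw [← map_mul, ← hQ, hN]
  obtain ⟨k, hk, hPk⟩ := (Nat.dvd_prime_pow hp).1 ⟨_, hPQ.symm⟩
  have hP1 : Ideal.absNorm P ≠ 1 := fun h => hPmax.ne_top (Ideal.absNorm_eq_one_iff.1 h)
  interval_cases k
  · simp [hPk] at hP1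
  · have hPp : Ideal.absNorm P = p := by simpa using hPk
    have hQp : Ideal.absNorm Q = p := by
      rw [hPp, sq] at hPQ
      exact mul_left_cancel₀ hp.ne_zero hPQ
    by_cases hne : P = Q
    · exact Or.inl ⟨P, hPmax.isPrime, by rw [hQ, ← hne, sq], hPp⟩
    · exact Or.inr (Or.inl ⟨P, Q, hPmax.isPrime, Ideal.isPrime_of_absNorm_eq_prime hp hQp, hne,
        hQ, hPp, hQp⟩)
  · have hQ1 : Ideal.absNorm Q = 1 := by
      rw [hPk] at hPQ
      exact (mul_eq_left₀ (pow_ne_zero 2 hp.ne_zero)).1 hPQ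
    rw [Ideal.absNorm_eq_one_iff.1 hQ1, Ideal.mul_top] at hQ
    exact Or.inr (Or.inr ⟨hQ ▸ hPmax.isPrime, hN⟩)

theorem span_natCast_ne_bot {K : Type*} [Field K] [NumberField K] {n : ℕ} (hn : n ≠ 0) :
    Ideal.span {(n : NumberField.RingOfIntegers K)} ≠ ⊥ := by
  simpa using hn

theorem not_isSplitPrime_of_isRamifiedPrime {K : Type*} [Field K] [NumberField K] {p : ℕ}
    (hp : p.Prime) (h : IsRamifiedPrime K p) : ¬ IsSplitPrime K p := by
  obtain ⟨P, hP, hpP, -⟩ := h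
  rintro ⟨P₁, P₂, h₁, h₂, hne, h₁₂, -, -⟩
  have hbot := span_natCast_ne_bot (K := K) hp.ne_zero
  have hbot' : P₁ ≠ ⊥ ∧ P₂ ≠ ⊥ := by
    rw [h₁₂, ← Ideal.zero_eq_bot] at hbot
    exact mul_ne_zero_iff.1 hbot
  have hle : ∀ Q : Ideal (NumberField.RingOfIntegers K), Q.IsPrime → Q ≠ ⊥ → Q ∣ P ^ 2 → P = Q := by
    intro Q hQ hQ0 hd
    have hdP : Q ∣ P := (Ideal.prime_of_isPrime hQ0 hQ).dvd_of_dvd_pow hd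
    have hP0 : P ≠ ⊥ := by
      rintro rfl
      exact hbot (by rw [hpP]; simp)
    exact (hP.isMaximal hP0).eq_of_le hQ.ne_top (Ideal.dvd_iff_le.1 hdP)
  refine hne ((hle P₁ h₁ hbot'.1 ?_).symm.trans (hle P₂ h₂ hbot'.2 ?_))
  · rw [← hpP, h₁₂]; exact dvd_mul_right _ _
  · rw [← hpP, h₁₂]; exact dvd_mul_left _ _

theorem not_isInertPrime_of_eq_mul {K : Type*} [Field K] [NumberField K] {p : ℕ}
    (hp : p.Prime) {P Q : Ideal (NumberField.RingOfIntegers K)}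
    (hPQ : Ideal.span {(p : NumberField.RingOfIntegers K)} = P * Q)
    (hP : P.IsPrime) (hQ : Q.IsPrime) : ¬ IsInertPrime K p := by
  rintro ⟨hprime, -⟩
  have hirr := (Ideal.prime_of_isPrime (span_natCast_ne_bot hp.ne_zero) hprime).irreducible
  rcases hirr.isUnit_or_isUnit hPQ with h | h
  · exact hP.ne_top (Ideal.isUnit_iff.1 h)
  · exact hQ.ne_top (Ideal.isUnit_iff.1 h)

theorem not_isInertPrime_of_isRamifiedPrime {K : Type*} [Field K] [NumberField K] {p : ℕ}
    (hp : p.Prime) (h : IsRamifiedPrime K p) : ¬ IsInertPrime K p := by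
  obtain ⟨P, hP, hpP, -⟩ := h
  exact not_isInertPrime_of_eq_mul hp (hpP.trans (sq P)) hP hP

theorem not_isInertPrime_of_isSplitPrime {K : Type*} [Field K] [NumberField K] {p : ℕ}
    (hp : p.Prime) (h : IsSplitPrime K p) : ¬ IsInertPrime K p := by
  obtain ⟨P₁, P₂, h₁, h₂, -, h₁₂, -, -⟩ := h
  exact not_isInertPrime_of_eq_mul hp h₁₂ h₁ h₂

/-- The ramified primes of a quadratic field are the prime divisors of its discriminant. -/
theorem isRamifiedPrime_iff_dvd_discr {K : Type*} [Field K] [NumberField K]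
    (hK2 : Module.finrank ℚ K = 2) {p : ℕ} (hp : p.Prime) :
    IsRamifiedPrime K p ↔ (p : ℤ) ∣ NumberField.discr K := by
  have hpZ : Prime (p : ℤ) := Nat.prime_iff_prime_int.1 hp
  have hmap : (Ideal.span {(p : ℤ)}).map (algebraMap ℤ (NumberField.RingOfIntegers K)) =
      Ideal.span {(p : NumberField.RingOfIntegers K)} := by
    simp [Ideal.map_span]
  have hpmax : (Ideal.span {(p : ℤ)}).IsMaximal :=
    ((Ideal.span_singleton_prime hpZ.ne_zero).2 hpZ).isMaximal (by simpa using hpZ.ne_zero)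
  constructor
  · rintro ⟨P, hP, hpP, hPN⟩
    have hd : P ^ (2 - 1) ∣ differentIdeal ℤ (NumberField.RingOfIntegers K) :=
      pow_sub_one_dvd_differentIdeal ℤ (p := Ideal.span {(p : ℤ)}) P 2
        (by simpa using hp.ne_zero) (by rw [hmap, hpP])
    rw [← Int.dvd_natAbs, ← NumberField.absNorm_differentIdeal K (NumberField.RingOfIntegers K)]
    have := Ideal.absNorm_dvd_absNorm_of_le (Ideal.dvd_iff_le.1 hd)
    rw [pow_one, hPN] at this
    exact_mod_cast this
  · contrapose!
    intro hram
    rw [NumberField.not_dvd_discr_iff_forall_liesOver K (NumberField.RingOfIntegers K) hpZ]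
    intro P hP hover
    have hle : (Ideal.span {(p : ℤ)}).map (algebraMap ℤ (NumberField.RingOfIntegers K)) ≤ P :=
      Ideal.map_le_iff_le_comap.2 hover.over.le
    rw [← Ideal.ramificationIdx_eq_one_iff,
      ← Ideal.ramificationIdx'_eq_ramificationIdx (Ideal.span {(p : ℤ)}) P
        (by simpa using hp.ne_zero)]
    refine Ideal.ramificationIdx'_spec (by simpa using hle) fun h => hram ?_
    rw [hmap] at h
    exact isRamifiedPrime_of_sq_dvd hK2 hp hP.isPrime (Ideal.dvd_iff_le.2 h)


theorem rK_eq_card {K : Type*} [Field K] [NumberField K] {n : ℕ} (hn : n ≠ 0) :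
    rK K n = Nat.card {I : Ideal (NumberField.RingOfIntegers K) // Ideal.absNorm I = n} := by
  refine Nat.card_congr (Equiv.subtypeEquivRight fun I => and_iff_left_of_imp ?_)
  rintro rfl rfl
  exact hn Ideal.absNorm_bot

theorem rK_zero (K : Type*) [Field K] [NumberField K] : rK K 0 = 0 := by
  rw [rK, Nat.card_eq_zero]
  exact Or.inl ⟨fun I => I.2.2 (Ideal.absNorm_eq_zero_iff.1 I.2.1)⟩

theorem rK_one (K : Type*) [Field K] [NumberField K] : rK K 1 = 1 := by
  rw [rK_eq_card one_ne_zero, Nat.card_eq_one_iff_exists]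
  exact ⟨⟨⊤, Ideal.absNorm_top⟩, fun I => Subtype.ext (Ideal.absNorm_eq_one_iff.1 I.2)⟩

theorem Ideal.isRelPrime_of_absNorm_coprime {K : Type*} [Field K] [NumberField K]
    {I J : Ideal (NumberField.RingOfIntegers K)}
    (h : (Ideal.absNorm I).Coprime (Ideal.absNorm J)) : IsRelPrime I J := by
  intro L hI hJ
  have hL : Ideal.absNorm L ∣ 1 := by
    rw [← Nat.coprime_iff_gcd_eq_one.1 h]
    exact Nat.dvd_gcd (map_dvd Ideal.absNorm hI) (map_dvd Ideal.absNorm hJ)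
  exact Ideal.isUnit_iff.2 (Ideal.absNorm_eq_one_iff.1 (Nat.dvd_one.1 hL))

theorem Nat.eq_of_mul_eq_mul_of_dvd_pow {a b m n k : ℕ} (hmn : m.Coprime n)
    (h : a * b = m * n) (ha : a ∣ m ^ k) (hb : b ∣ n ^ k) : a = m ∧ b = n := by
  have han : a.Coprime n := Nat.Coprime.coprime_dvd_left ha (hmn.pow_left k)
  have hbm : b.Coprime m := Nat.Coprime.coprime_dvd_left hb (hmn.symm.pow_left k)
  exact ⟨Nat.dvd_antisymm (han.dvd_of_dvd_mul_right (h ▸ dvd_mul_right a b))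
      (hbm.symm.dvd_of_dvd_mul_right (h ▸ dvd_mul_right m n)),
    Nat.dvd_antisymm (hbm.dvd_of_dvd_mul_left (h ▸ dvd_mul_left b a))
      (han.symm.dvd_of_dvd_mul_left (h ▸ dvd_mul_left n m))⟩

theorem rK_mul_of_coprime {K : Type*} [Field K] [NumberField K] {m n : ℕ} (hmn : m.Coprime n) :
    rK K (m * n) = rK K m * rK K n := by
  rcases eq_or_ne m 0 with rfl | hm
  · simp [rK_zero]
  rcases eq_or_ne n 0 with rfl | hn
  · simp [rK_zero]
  rw [rK_eq_card (mul_ne_zero hm hn), rK_eq_card hm, rK_eq_card hn, ← Nat.card_prod]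
  symm
  refine Nat.card_congr (Equiv.ofBijective
    (fun IJ => ⟨IJ.1.1 * IJ.2.1, by rw [map_mul, IJ.1.2, IJ.2.2]⟩) ⟨?_, ?_⟩)
  · rintro ⟨⟨I, hI⟩, J, hJ⟩ ⟨⟨I', hI'⟩, J', hJ'⟩ h
    have h : I * J = I' * J' := congrArg Subtype.val h
    have key : ∀ {A B A' B' : Ideal (NumberField.RingOfIntegers K)} {a b : ℕ}, a.Coprime b →
        Ideal.absNorm A = a → Ideal.absNorm B' = b → A * B = A' * B' → A ∣ A' := by
      intro A B A' B' a b hab hA hB' hAB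
      have hrel : IsRelPrime A B' := Ideal.isRelPrime_of_absNorm_coprime (by rwa [hA, hB'])
      exact hrel.dvd_of_dvd_mul_right (hAB ▸ dvd_mul_right A B)
    have hII' : I = I' := dvd_antisymm (key hmn hI hJ' h) (key hmn hI' hJ h.symm)
    have hJJ' : J = J' := by
      rw [mul_comm I, mul_comm I'] at h
      exact dvd_antisymm (key hmn.symm hJ hI' h) (key hmn.symm hJ' hI h.symm)
    subst hII' hJJ'
    rfl
  · rintro ⟨L, hL⟩
    have hd := dvd_span_natCast_pow_of_absNorm_eq (p := m * n) (k := 1) (by rw [hL, pow_one])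
    rw [pow_one, Nat.cast_mul, ← Ideal.span_singleton_mul_span_singleton] at hd
    obtain ⟨I, J, hI, hJ, rfl⟩ := exists_dvd_and_dvd_of_dvd_mul hd
    have hI' := map_dvd Ideal.absNorm hI
    have hJ' := map_dvd Ideal.absNorm hJ
    rw [Ideal.absNorm_span_natCast] at hI' hJ'
    rw [map_mul] at hL
    obtain ⟨h₁, h₂⟩ := Nat.eq_of_mul_eq_mul_of_dvd_pow hmn hL hI' hJ'
    exact ⟨⟨⟨I, h₁⟩, J, h₂⟩, rfl⟩

theorem IsRamifiedPrime.rK_pow {K : Type*} [Field K] [NumberField K] {p : ℕ}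
    (h : IsRamifiedPrime K p) (hp : p.Prime) (k : ℕ) : rK K (p ^ k) = 1 := by
  obtain ⟨P, hP, hpP, hN⟩ := h
  have hP0 : P ≠ ⊥ := by
    rintro rfl
    exact hp.ne_zero (by rw [← hN, Ideal.absNorm_bot])
  rw [rK_eq_card (pow_ne_zero k hp.ne_zero), Nat.card_eq_one_iff_exists]
  refine ⟨⟨P ^ k, by rw [map_pow, hN]⟩, ?_⟩
  rintro ⟨I, hI⟩
  have hd := dvd_span_natCast_pow_of_absNorm_eq hI
  rw [hpP, ← pow_mul] at hd
  obtain ⟨j, -, hj⟩ := (dvd_prime_pow (Ideal.prime_of_isPrime hP0 hP) _).1 hd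
  rw [associated_iff_eq] at hj
  subst hj
  rw [map_pow, hN] at hI
  rw [Subtype.mk.injEq, Nat.pow_right_injective hp.two_le hI]

theorem IsInertPrime.rK_pow {K : Type*} [Field K] [NumberField K] {p : ℕ}
    (h : IsInertPrime K p) (hp : p.Prime) (k : ℕ) :
    rK K (p ^ k) = if Even k then 1 else 0 := by
  obtain ⟨hP, hN⟩ := h
  have key : ∀ I : Ideal (NumberField.RingOfIntegers K), Ideal.absNorm I = p ^ k →
      ∃ j, I = Ideal.span {(p : NumberField.RingOfIntegers K)} ^ j ∧ 2 * j = k := by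
    intro I hI
    obtain ⟨j, -, hj⟩ := (dvd_prime_pow
      (Ideal.prime_of_isPrime (span_natCast_ne_bot hp.ne_zero) hP) _).1
      (dvd_span_natCast_pow_of_absNorm_eq hI)
    rw [associated_iff_eq] at hj
    subst hj
    rw [map_pow, hN, ← pow_mul] at hI
    exact ⟨j, rfl, Nat.pow_right_injective hp.two_le hI⟩
  rw [rK_eq_card (pow_ne_zero k hp.ne_zero)]
  split_ifs with hk
  · obtain ⟨j, hj⟩ := hk
    rw [Nat.card_eq_one_iff_exists]
    refine ⟨⟨Ideal.span {(p : NumberField.RingOfIntegers K)} ^ j, by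
      rw [map_pow, hN, ← pow_mul, hj, two_mul]⟩, ?_⟩
    rintro ⟨I, hI⟩
    obtain ⟨i, rfl, hi⟩ := key I hI
    rw [Subtype.mk.injEq, show i = j by lia]
  · rw [Nat.card_eq_zero]
    refine Or.inl ⟨fun I => hk ?_⟩
    obtain ⟨j, -, hj⟩ := key I.1 I.2
    exact ⟨j, by lia⟩

theorem IsSplitPrime.rK_pow {K : Type*} [Field K] [NumberField K] {p : ℕ}
    (h : IsSplitPrime K p) (hp : p.Prime) (k : ℕ) : rK K (p ^ k) = k + 1 := by
  obtain ⟨P, Q, hP, hQ, hne, hpPQ, hNP, hNQ⟩ := h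
  have hP0 : P ≠ ⊥ := by
    rintro rfl
    exact hp.ne_zero (by rw [← hNP, Ideal.absNorm_bot])
  have hQ0 : Q ≠ ⊥ := by
    rintro rfl
    exact hp.ne_zero (by rw [← hNQ, Ideal.absNorm_bot])
  have hPp := Ideal.prime_of_isPrime hP0 hP
  have hQp := Ideal.prime_of_isPrime hQ0 hQ
  have hPQ : ∀ {a b c d : ℕ}, P ^ a * Q ^ b = P ^ c * Q ^ d → a ≤ c := by
    intro a b c d hab
    have hdvd : P ^ a ∣ P ^ c * Q ^ d := hab ▸ dvd_mul_right _ _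
    have hnd : ¬ P ∣ Q ^ d := fun hd =>
      hne (associated_iff_eq.1 ((hPp.dvd_prime_iff_associated hQp).1 (hPp.dvd_of_dvd_pow hd)))
    exact (pow_dvd_pow_iff hP0 hPp.not_isUnit).1 (hPp.pow_dvd_of_dvd_mul_right a hnd hdvd)
  rw [rK_eq_card (pow_ne_zero k hp.ne_zero), ← Nat.card_fin (k + 1)]
  symm
  refine Nat.card_congr (Equiv.ofBijective
    (fun i => ⟨P ^ (i : ℕ) * Q ^ (k - i), ?_⟩) ⟨?_, ?_⟩)
  · rw [map_mul, map_pow, map_pow, hNP, hNQ, ← pow_add, Nat.add_sub_of_le (by lia)]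
  · intro i j hij
    have hij : P ^ (i : ℕ) * Q ^ (k - i) = P ^ (j : ℕ) * Q ^ (k - j) := congrArg Subtype.val hij
    exact Fin.ext (le_antisymm (hPQ hij) (hPQ hij.symm))
  · rintro ⟨I, hI⟩
    have hd := dvd_span_natCast_pow_of_absNorm_eq hI
    rw [hpPQ, mul_pow] at hd
    obtain ⟨A, B, hA, hB, rfl⟩ := exists_dvd_and_dvd_of_dvd_mul hd
    obtain ⟨i, -, hi⟩ := (dvd_prime_pow hPp _).1 hA
    obtain ⟨j, -, hj⟩ := (dvd_prime_pow hQp _).1 hB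
    rw [associated_iff_eq] at hi hj
    subst hi hj
    rw [map_mul, map_pow, map_pow, hNP, hNQ, ← pow_add] at hI
    have hij : i + j = k := Nat.pow_right_injective hp.two_le hI
    refine ⟨⟨i, by lia⟩, Subtype.ext ?_⟩
    simp [← hij]

theorem rK_prime_pow_le {K : Type*} [Field K] [NumberField K] (hK2 : Module.finrank ℚ K = 2)
    {p : ℕ} (hp : p.Prime) (k : ℕ) : rK K (p ^ k) ≤ k + 1 := by
  rcases isRamified_or_isSplit_or_isInert hK2 hp with h | h | h
  · simp [h.rK_pow hp]
  · rw [h.rK_pow hp]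
  · rw [h.rK_pow hp]
    split_ifs <;> lia

theorem multipliable_and_norm_tprod_le {ι : Type*} {f : ι → ℂ} {u : ι → ℝ} (hu : Summable u)
    (hf : ∀ i, ‖f i - 1‖ ≤ u i) :
    Multipliable f ∧ ‖∏' i, f i‖ ≤ Real.exp (∑' i, u i) := by
  have hsum : Summable fun i => ‖f i - 1‖ := hu.of_nonneg_of_le (fun _ => norm_nonneg _) hf
  have hm : Multipliable f := by
    simpa using multipliable_one_add_of_summable hsum
  refine ⟨hm, le_of_tendsto hm.hasProd.norm (Filter.Eventually.of_forall fun t => ?_)⟩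
  have h := Finset.norm_prod_one_add_sub_one_le t fun i => f i - 1
  simp only [add_sub_cancel] at h
  have htri : ‖∏ i ∈ t, f i‖ ≤ ‖∏ i ∈ t, f i - 1‖ + 1 := by
    simpa using norm_add_le (∏ i ∈ t, f i - 1) 1
  have hle : ∑ i ∈ t, ‖f i - 1‖ ≤ ∑' i, u i :=
    (Finset.sum_le_sum fun i _ => hf i).trans
      (hu.sum_le_tsum t fun i _ => (norm_nonneg _).trans (hf i))
  have hexp := Real.exp_le_exp.2 hle
  rw [← norm_prod]
  linarith

theorem differentiableOn_tprod_of_summable {ι : Type*} {f : ι → ℂ → ℂ} {u : ι → ℝ} {U : Set ℂ}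
    (hU : IsOpen U) (hu : Summable u) (hd : ∀ i, DifferentiableOn ℂ (f i) U)
    (hf : ∀ i, ∀ s ∈ U, ‖f i s - 1‖ ≤ u i) :
    DifferentiableOn ℂ (fun s => ∏' i, f i s) U := by
  have h := hu.hasProdLocallyUniformlyOn_one_add (f := fun i s => f i s - 1) hU
    (Filter.Eventually.of_forall hf) fun i => ((hd i).sub_const 1).continuousOn
  simp only [add_sub_cancel] at h
  exact h.differentiableOn (Filter.Eventually.of_forall fun t => by
    simpa [Finset.prod_fn] using DifferentiableOn.finsetProd fun i _ => hd i) hU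

theorem Complex.natCast_cpow_neg_natCast_mul (p n : ℕ) (s : ℂ) :
    (p : ℂ) ^ (-(n * s)) = ((p : ℂ) ^ (-s)) ^ n := by
  rw [← Complex.cpow_nat_mul, mul_neg]

theorem Nat.Prime.norm_cpow_neg_le {p : ℕ} (hp : p.Prime) {θ : ℝ} {s : ℂ} (hs : θ ≤ s.re) :
    ‖(p : ℂ) ^ (-s)‖ ≤ (p : ℝ) ^ (-θ) := by
  rw [Complex.norm_natCast_cpow_of_pos hp.pos, Complex.neg_re]
  exact Real.rpow_le_rpow_of_exponent_le (mod_cast hp.one_le) (by linarith)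

theorem Nat.Prime.norm_cpow_neg_pow_three_le {p : ℕ} (hp : p.Prime) {θ : ℝ} {s : ℂ}
    (hs : θ ≤ s.re) : ‖(p : ℂ) ^ (-s)‖ ^ 3 ≤ (p : ℝ) ^ (-(3 * θ)) := by
  calc ‖(p : ℂ) ^ (-s)‖ ^ 3 ≤ ((p : ℝ) ^ (-θ)) ^ 3 := by
        gcongr
        exact hp.norm_cpow_neg_le hs
    _ = (p : ℝ) ^ (-(3 * θ)) := by
        rw [← Real.rpow_mul_natCast (by positivity)]
        congr 1
        push_cast
        ring

theorem Nat.Prime.norm_cpow_neg_le_half {p : ℕ} (hp : p.Prime) {s : ℂ} (hs : 1 ≤ s.re) :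
    ‖(p : ℂ) ^ (-s)‖ ≤ 1 / 2 := by
  refine (hp.norm_cpow_neg_le hs).trans ?_
  rw [Real.rpow_neg_one, one_div]
  exact inv_anti₀ two_pos (mod_cast hp.two_le)

theorem Nat.Prime.norm_cpow_neg_lt {p : ℕ} (hp : p.Prime) {s : ℂ} (hs : 1 / 3 ≤ s.re) :
    ‖(p : ℂ) ^ (-s)‖ < 4 / 5 := by
  have h := hp.norm_cpow_neg_pow_three_le hs
  rw [mul_one_div_cancel three_ne_zero, Real.rpow_neg_one] at h
  have hp2 : (p : ℝ)⁻¹ ≤ 2⁻¹ := inv_anti₀ two_pos (mod_cast hp.two_le)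
  refine lt_of_pow_lt_pow_left₀ 3 (by norm_num) (h.trans_lt (hp2.trans_lt ?_))
  norm_num

theorem Nat.Primes.summable_rpow_neg_three_mul {θ : ℝ} (hθ : 1 / 3 < θ) :
    Summable fun p : Nat.Primes => ((p : ℕ) : ℝ) ^ (-(3 * θ)) :=
  Nat.Primes.summable_rpow.2 (by linarith)

/-- An Euler product with local factors `F (p ^ (-s))`, normally convergent on `θ < re s`,
converges, is bounded and is holomorphic there. -/
theorem eulerProduct_multipliable_bounded_differentiableOn {P : Nat.Primes → Prop} {F : ℂ → ℂ}
    {θ : ℝ} (hθ : 1 / 3 ≤ θ) (hF : ∀ x, ‖x‖ < 4 / 5 → DifferentiableAt ℂ F x)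
    {u : {p // P p} → ℝ} (hu : Summable u)
    (hFu : ∀ (p : {p // P p}) (s : ℂ), θ < s.re → ‖F ((p.1.1 : ℂ) ^ (-s)) - 1‖ ≤ u p) :
    (∀ s : ℂ, θ < s.re → Multipliable fun p : {p // P p} => F ((p.1.1 : ℂ) ^ (-s))) ∧
    (∃ M : ℝ, ∀ s : ℂ, θ < s.re → ‖∏' p : {p // P p}, F ((p.1.1 : ℂ) ^ (-s))‖ ≤ M) ∧
    DifferentiableOn ℂ (fun s : ℂ => ∏' p : {p // P p}, F ((p.1.1 : ℂ) ^ (-s))) {s : ℂ | θ < s.re} := by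
  refine ⟨fun s hs => (multipliable_and_norm_tprod_le hu fun p => hFu p s hs).1,
    ⟨_, fun s hs => (multipliable_and_norm_tprod_le hu fun p => hFu p s hs).2⟩,
    differentiableOn_tprod_of_summable (isOpen_lt continuous_const Complex.continuous_re) hu
      (fun p s hs => ?_) hFu⟩
  have hd : DifferentiableAt ℂ (fun s : ℂ => (p.1.1 : ℂ) ^ (-s)) s :=
    differentiableAt_id.neg.const_cpow (Or.inl (mod_cast p.1.2.ne_zero))
  exact ((hF _ (p.1.2.norm_cpow_neg_lt (hθ.trans hs.le))).comp s hd).differentiableWithinAt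

theorem inv_norm_one_sub_sq_le {x : ℂ} (hx : ‖x‖ < 4 / 5) : ‖(1 - x ^ 2)⁻¹‖ ≤ 3 := by
  have h := norm_sub_norm_le (1 : ℂ) (x ^ 2)
  rw [norm_one, norm_pow] at h
  rw [norm_inv]
  refine inv_le_of_inv_le₀ three_pos ?_
  nlinarith [norm_nonneg x]

theorem one_sub_pow_ne_zero {x : ℂ} (hx : ‖x‖ < 1) {n : ℕ} (hn : n ≠ 0) : 1 - x ^ n ≠ 0 := by
  intro h
  have h1 : ‖x ^ n‖ < 1 := by
    rw [norm_pow]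
    exact pow_lt_one₀ (norm_nonneg x) hx hn
  rw [← sub_eq_zero.1 h, norm_one] at h1
  exact lt_irrefl _ h1

/-- Local factor of `G` at a ramified prime. -/
noncomputable def ramifiedFactor (x : ℂ) : ℂ := (1 - x) * ((1 - x ^ 2) ^ 2)⁻¹

/-- Local factor of `G` at a split prime. -/
noncomputable def splitFactor (x : ℂ) : ℂ := (1 + 2 * x) * (1 - x) ^ 2 * ((1 - x ^ 2) ^ 3)⁻¹

/-- Local factor of `G` at an inert prime. -/
noncomputable def inertFactor (x : ℂ) : ℂ := (1 - x ^ 4)⁻¹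

theorem differentiableAt_ramifiedFactor {x : ℂ} (hx : ‖x‖ < 4 / 5) :
    DifferentiableAt ℂ ramifiedFactor x := by
  have h := one_sub_pow_ne_zero (hx.trans (by norm_num)) two_ne_zero
  unfold ramifiedFactor
  fun_prop (disch := exact pow_ne_zero _ h)

theorem differentiableAt_splitFactor {x : ℂ} (hx : ‖x‖ < 4 / 5) :
    DifferentiableAt ℂ splitFactor x := by
  have h := one_sub_pow_ne_zero (hx.trans (by norm_num)) two_ne_zero
  unfold splitFactor
  fun_prop (disch := exact pow_ne_zero _ h)

theorem differentiableAt_inertFactor {x : ℂ} (hx : ‖x‖ < 4 / 5) :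
    DifferentiableAt ℂ inertFactor x := by
  have h := one_sub_pow_ne_zero (hx.trans (by norm_num)) four_ne_zero
  unfold inertFactor
  fun_prop (disch := exact h)

theorem norm_ramifiedFactor_sub_one_le {x : ℂ} (hx : ‖x‖ < 4 / 5) :
    ‖ramifiedFactor x - 1‖ ≤ 19 := by
  have h1 : ‖1 - x‖ ≤ 2 := (norm_sub_le _ _).trans (by rw [norm_one]; linarith)
  have h2 : ‖ramifiedFactor x‖ ≤ 2 * 3 ^ 2 := by
    rw [ramifiedFactor, ← inv_pow, norm_mul, norm_pow]
    gcongr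
    exact inv_norm_one_sub_sq_le hx
  refine (norm_sub_le _ _).trans ?_
  rw [norm_one]
  linarith

theorem norm_splitFactor_sub_one_le {x : ℂ} (hx : ‖x‖ < 4 / 5) :
    ‖splitFactor x - 1‖ ≤ 162 * ‖x‖ ^ 3 := by
  have h := one_sub_pow_ne_zero (hx.trans (by norm_num)) two_ne_zero
  have heq : splitFactor x - 1 = x ^ 3 * (2 - 3 * x + x ^ 3) * ((1 - x ^ 2)⁻¹) ^ 3 := by
    rw [splitFactor]
    field_simp
    ring
  have h1 : ‖2 - 3 * x + x ^ 3‖ ≤ 6 := by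
    refine (norm_add_le_of_le (norm_sub_le _ _) le_rfl).trans ?_
    rw [norm_mul, norm_pow, Complex.norm_ofNat, Complex.norm_ofNat]
    have := pow_le_one₀ (n := 3) (norm_nonneg x) (by linarith)
    linarith
  rw [heq, norm_mul, norm_mul, norm_pow, norm_pow]
  calc ‖x‖ ^ 3 * ‖2 - 3 * x + x ^ 3‖ * ‖(1 - x ^ 2)⁻¹‖ ^ 3 ≤ ‖x‖ ^ 3 * 6 * 3 ^ 3 := by
        gcongr
        exact inv_norm_one_sub_sq_le hx
    _ = 162 * ‖x‖ ^ 3 := by ring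

theorem norm_inertFactor_sub_one_le {x : ℂ} (hx : ‖x‖ < 4 / 5) :
    ‖inertFactor x - 1‖ ≤ 162 * ‖x‖ ^ 3 := by
  have h := one_sub_pow_ne_zero (hx.trans (by norm_num)) four_ne_zero
  have heq : inertFactor x - 1 = x ^ 3 * x * (1 - x ^ 4)⁻¹ := by
    rw [inertFactor]
    field_simp
    ring
  have hx2 : ‖x ^ 2‖ < 4 / 5 := by
    rw [norm_pow]
    nlinarith [norm_nonneg x]
  have h1 := inv_norm_one_sub_sq_le hx2
  rw [← pow_mul] at h1
  rw [heq, norm_mul, norm_mul, norm_pow]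
  calc ‖x‖ ^ 3 * ‖x‖ * ‖(1 - x ^ 4)⁻¹‖ ≤ ‖x‖ ^ 3 * 1 * 3 := by
        gcongr
        linarith
    _ ≤ 162 * ‖x‖ ^ 3 := by nlinarith [pow_nonneg (norm_nonneg x) 3]

theorem eulerProduct_of_norm_sub_one_le_pow_three {P : Nat.Primes → Prop} {F : ℂ → ℂ}
    {θ C : ℝ} (hθ : 1 / 3 < θ) (hC : 0 ≤ C)
    (hF : ∀ x, ‖x‖ < 4 / 5 → DifferentiableAt ℂ F x)
    (hFC : ∀ x, ‖x‖ < 4 / 5 → ‖F x - 1‖ ≤ C * ‖x‖ ^ 3) :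
    (∀ s : ℂ, θ < s.re → Multipliable fun p : {p // P p} => F ((p.1.1 : ℂ) ^ (-s))) ∧
    (∃ M : ℝ, ∀ s : ℂ, θ < s.re → ‖∏' p : {p // P p}, F ((p.1.1 : ℂ) ^ (-s))‖ ≤ M) ∧
    DifferentiableOn ℂ (fun s : ℂ => ∏' p : {p // P p}, F ((p.1.1 : ℂ) ^ (-s))) {s : ℂ | θ < s.re} := by
  refine eulerProduct_multipliable_bounded_differentiableOn hθ.le hF
    (((Nat.Primes.summable_rpow_neg_three_mul hθ).mul_left C).subtype _) fun p s hs => ?_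
  refine (hFC _ (p.1.2.norm_cpow_neg_lt (hθ.le.trans hs.le))).trans ?_
  exact mul_le_mul_of_nonneg_left (p.1.2.norm_cpow_neg_pow_three_le hs.le) hC

theorem Nat.Primes.finite_dvd_int {D : ℤ} (hD : D ≠ 0) :
    Finite {p : Nat.Primes // (p.1 : ℤ) ∣ D} := by
  refine Set.Finite.subset (s := {p : Nat.Primes | p.1 ∈ D.natAbs.divisors}) ?_ fun p hp => ?_
  · exact (Finset.finite_toSet _).preimage Subtype.val_injective.injOn
  · have hp : (p.1 : ℤ) ∣ D := hp
    simpa [hD, ← Int.natCast_dvd] using hp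

theorem eulerProduct_ramifiedFactor {D : ℤ} (hD : D ≠ 0) {θ : ℝ} (hθ : 1 / 3 ≤ θ) :
    (∀ s : ℂ, θ < s.re → Multipliable fun p : {p : Nat.Primes // (p.1 : ℤ) ∣ D} =>
      ramifiedFactor ((p.1.1 : ℂ) ^ (-s))) ∧
    (∃ M : ℝ, ∀ s : ℂ, θ < s.re → ‖∏' p : {p : Nat.Primes // (p.1 : ℤ) ∣ D},
      ramifiedFactor ((p.1.1 : ℂ) ^ (-s))‖ ≤ M) ∧
    DifferentiableOn ℂ (fun s : ℂ => ∏' p : {p : Nat.Primes // (p.1 : ℤ) ∣ D},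
      ramifiedFactor ((p.1.1 : ℂ) ^ (-s))) {s : ℂ | θ < s.re} := by
  have := Nat.Primes.finite_dvd_int hD
  exact eulerProduct_multipliable_bounded_differentiableOn hθ
    (fun x => differentiableAt_ramifiedFactor) (u := fun _ => 19) (Summable.of_finite)
    fun p s hs => norm_ramifiedFactor_sub_one_le (p.1.2.norm_cpow_neg_lt (hθ.trans hs.le))

theorem ArithmeticFunction.sq_le_sigma_zero_mul_sigma_zero {p : ℕ} (hp : p.Prime) (k : ℕ) :
    (k + 1) ^ 2 ≤ (ArithmeticFunction.sigma 0 * ArithmeticFunction.sigma 0) (p ^ k) := by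
  rw [ArithmeticFunction.mul_apply,
    Nat.sum_divisorsAntidiagonal fun i j =>
      ArithmeticFunction.sigma 0 i * ArithmeticFunction.sigma 0 j,
    Nat.sum_divisors_prime_pow hp]
  have hle : ∀ i ∈ Finset.range (k + 1), k + 1 ≤
      ArithmeticFunction.sigma 0 (p ^ i) * ArithmeticFunction.sigma 0 (p ^ k / p ^ i) := by
    intro i hi
    have hik : i ≤ k := Nat.lt_succ_iff.1 (Finset.mem_range.1 hi)
    obtain ⟨j, rfl⟩ := Nat.exists_eq_add_of_le hik
    rw [Nat.pow_div hik hp.pos, Nat.add_sub_cancel_left,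
      ArithmeticFunction.sigma_zero_apply_prime_pow hp,
      ArithmeticFunction.sigma_zero_apply_prime_pow hp]
    nlinarith [Nat.zero_le (i * j)]
  simpa [sq] using Finset.sum_le_sum hle

theorem LSeriesSummable_sigma_zero_mul_sigma_zero {s : ℂ} (hs : 1 < s.re) :
    LSeriesSummable (fun n =>
      ((ArithmeticFunction.sigma 0 * ArithmeticFunction.sigma 0) n : ℂ)) s := by
  have hζ : LSeriesSummable
      (fun n => ((ArithmeticFunction.zeta : ArithmeticFunction ℂ) n)) s := by
    simpa [-ArithmeticFunction.zeta_apply] using ArithmeticFunction.LSeriesSummable_zeta_iff.2 hs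
  have hσ : LSeriesSummable
      (fun n => ((ArithmeticFunction.sigma 0 : ArithmeticFunction ℕ) : ArithmeticFunction ℂ) n)
      s := by
    rw [← ArithmeticFunction.zeta_mul_pow_eq_sigma, ArithmeticFunction.pow_zero_eq_zeta,
      ArithmeticFunction.natCoe_mul]
    exact ArithmeticFunction.LSeriesSummable_mul hζ hζ
  have h := ArithmeticFunction.LSeriesSummable_mul hσ hσ
  rw [← ArithmeticFunction.natCoe_mul] at h
  simpa using h

theorem le_of_prime_pow_le_of_coprime {a b : ℕ → ℕ} (h0 : a 0 ≤ b 0) (h1 : a 1 ≤ b 1)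
    (hp : ∀ p k : ℕ, p.Prime → a (p ^ k) ≤ b (p ^ k))
    (ha : ∀ {m n : ℕ}, m.Coprime n → a (m * n) = a m * a n)
    (hb : ∀ {m n : ℕ}, m.Coprime n → b (m * n) = b m * b n) (n : ℕ) : a n ≤ b n := by
  induction n using Nat.recOnPosPrimePosCoprime with
  | prime_pow p k hpp _ => exact hp p k hpp
  | zero => exact h0
  | one => exact h1
  | coprime m n _ _ hmn hm hn =>
    rw [ha hmn, hb hmn]
    exact Nat.mul_le_mul hm hn

theorem LSeriesSummable_of_prime_pow_le {a : ℕ → ℕ} (h0 : a 0 = 0) (h1 : a 1 = 1)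
    (hmul : ∀ {m n : ℕ}, m.Coprime n → a (m * n) = a m * a n)
    (hle : ∀ p k : ℕ, p.Prime → a (p ^ k) ≤ (k + 1) ^ 2) {s : ℂ} (hs : 1 < s.re) :
    LSeriesSummable (fun n => (a n : ℂ)) s := by
  have hσ : (ArithmeticFunction.sigma 0 * ArithmeticFunction.sigma 0).IsMultiplicative :=
    ArithmeticFunction.isMultiplicative_sigma.mul ArithmeticFunction.isMultiplicative_sigma
  have hbound := le_of_prime_pow_le_of_coprime
    (b := (ArithmeticFunction.sigma 0 * ArithmeticFunction.sigma 0 : ArithmeticFunction ℕ))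
    (by simp [h0]) (by rw [h1, hσ.map_one])
    (fun p k hp => (hle p k hp).trans
      (ArithmeticFunction.sq_le_sigma_zero_mul_sigma_zero hp k)) hmul hσ.2
  refine (LSeriesSummable_sigma_zero_mul_sigma_zero hs).norm.of_norm_bounded fun n => ?_
  refine LSeries.norm_term_le s ?_
  rw [Complex.norm_natCast, Complex.norm_natCast]
  exact_mod_cast hbound n

/-- Euler product of the `L`-series of a multiplicative function. -/
theorem hasProd_LSeries_of_coprime {a : ℕ → ℂ} (h1 : a 1 = 1)
    (hmul : ∀ {m n : ℕ}, m.Coprime n → a (m * n) = a m * a n) {s : ℂ}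
    (hs : LSeriesSummable a s) :
    HasProd (fun p : Nat.Primes => ∑' e : ℕ, a (p ^ e) * (((p : ℕ) : ℂ) ^ (-s)) ^ e)
      (LSeries a s) := by
  have hterm : ∀ n : ℕ, n ≠ 0 → LSeries.term a s n = a n * (n : ℂ) ^ (-s) := fun n hn => by
    rw [LSeries.term_of_ne_zero hn, Complex.cpow_neg, div_eq_mul_inv]
  have h := EulerProduct.eulerProduct_hasProd (f := LSeries.term a s)
    (by rw [hterm 1 one_ne_zero, h1]; simp)
    (fun {m n} hmn => by
      rcases eq_or_ne m 0 with rfl | hm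
      · simp
      rcases eq_or_ne n 0 with rfl | hn
      · simp
      rw [hterm _ (mul_ne_zero hm hn), hterm m hm, hterm n hn, hmul hmn, Nat.cast_mul,
        Complex.natCast_mul_natCast_cpow]
      ring)
    hs.norm (LSeries.term_zero a s)
  convert! h using 4 with p e
  rw [hterm _ (pow_ne_zero e p.2.ne_zero), Nat.cast_pow, ← Complex.natCast_cpow_natCast_mul,
    Complex.cpow_nat_mul]

theorem tsum_ite_even_mul_pow {x : ℂ} (hx : ‖x‖ < 1) :
    ∑' e : ℕ, ((if Even e then 1 else 0 : ℕ) : ℂ) * x ^ e = (1 - x ^ 2)⁻¹ := by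
  have hx2 : ‖x ^ 2‖ < 1 := by
    rw [norm_pow]
    exact pow_lt_one₀ (norm_nonneg x) hx two_ne_zero
  have he : HasSum (fun k : ℕ => ((if Even (2 * k) then 1 else 0 : ℕ) : ℂ) * x ^ (2 * k))
      (1 - x ^ 2)⁻¹ := by
    simpa [pow_mul] using hasSum_geometric_of_norm_lt_one hx2
  have ho : HasSum (fun k : ℕ => ((if Even (2 * k + 1) then 1 else 0 : ℕ) : ℂ) * x ^ (2 * k + 1))
      0 := by
    simp
  exact (HasSum.even_add_odd
    (f := fun e : ℕ => ((if Even e then 1 else 0 : ℕ) : ℂ) * x ^ e) he ho).tsum_eq.trans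
    (add_zero _)

theorem tsum_natCast_mul_add_one_mul_pow {x : ℂ} (hx : ‖x‖ < 1) (j : ℕ) :
    ∑' e : ℕ, ((j * e + 1 : ℕ) : ℂ) * x ^ e = (1 + (j - 1) * x) * ((1 - x) ^ 2)⁻¹ := by
  have h := ((hasSum_coe_mul_geometric_of_norm_lt_one hx).mul_left (j : ℂ)).add
    (hasSum_geometric_of_norm_lt_one hx)
  have hx1 : 1 - x ≠ 0 := by
    simpa using one_sub_pow_ne_zero hx one_ne_zero
  convert! h.tsum_eq using 1
  · congr 1 with e
    push_cast
    ring
  · field_simp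
    ring

/-- The local factor at `p` of the Dirichlet series `∑ r_K(n ^ j) n ^ (-s)`, with
`x = p ^ (-s)`. -/
noncomputable def rKLocalFactor (K : Type*) [Field K] [NumberField K] (j p : ℕ) (x : ℂ) : ℂ :=
  ∑' e : ℕ, (rK K ((p ^ e) ^ j) : ℂ) * x ^ e

theorem IsRamifiedPrime.rKLocalFactor_eq {K : Type*} [Field K] [NumberField K] {p : ℕ}
    (h : IsRamifiedPrime K p) (hp : p.Prime) (j : ℕ) {x : ℂ} (hx : ‖x‖ < 1) :
    rKLocalFactor K j p x = (1 - x)⁻¹ := by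
  simp [rKLocalFactor, ← pow_mul, h.rK_pow hp, tsum_geometric_of_norm_lt_one hx]

theorem IsSplitPrime.rKLocalFactor_eq {K : Type*} [Field K] [NumberField K] {p : ℕ}
    (h : IsSplitPrime K p) (hp : p.Prime) (j : ℕ) {x : ℂ} (hx : ‖x‖ < 1) :
    rKLocalFactor K j p x = (1 + (j - 1) * x) * ((1 - x) ^ 2)⁻¹ := by
  simp only [rKLocalFactor, ← pow_mul, h.rK_pow hp, mul_comm _ j]
  exact tsum_natCast_mul_add_one_mul_pow hx j

theorem IsInertPrime.rKLocalFactor_eq {K : Type*} [Field K] [NumberField K] {p : ℕ}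
    (h : IsInertPrime K p) (hp : p.Prime) {j : ℕ} (hj : Odd j) {x : ℂ} (hx : ‖x‖ < 1) :
    rKLocalFactor K j p x = (1 - x ^ 2)⁻¹ := by
  simp only [rKLocalFactor, ← pow_mul, h.rK_pow hp, Nat.even_mul, Nat.not_even_iff_odd.2 hj,
    or_false]
  exact tsum_ite_even_mul_pow hx

theorem LSeriesSummable_rK_pow {K : Type*} [Field K] [NumberField K]
    (hK2 : Module.finrank ℚ K = 2) {j : ℕ} (hj0 : j ≠ 0) (hj : j ≤ 3) {s : ℂ} (hs : 1 < s.re) :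
    LSeriesSummable (fun n => (rK K (n ^ j) : ℂ)) s := by
  refine LSeriesSummable_of_prime_pow_le (a := fun n => rK K (n ^ j)) (by simp [hj0, rK_zero])
    (by simp [rK_one]) (fun {m n} hmn => ?_) (fun p k hp => ?_) hs
  · rw [mul_pow, rK_mul_of_coprime (hmn.pow j j)]
  · rw [← pow_mul]
    refine (rK_prime_pow_le hK2 hp _).trans ?_
    nlinarith [Nat.mul_le_mul_left k hj, Nat.le_mul_self k]

theorem hasProd_rKLocalFactor {K : Type*} [Field K] [NumberField K]
    (hK2 : Module.finrank ℚ K = 2) {j : ℕ} (hj0 : j ≠ 0) (hj : j ≤ 3) {s : ℂ} (hs : 1 < s.re) :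
    HasProd (fun p : Nat.Primes => rKLocalFactor K j p ((p : ℂ) ^ (-s)))
      (LSeries (fun n => (rK K (n ^ j) : ℂ)) s) := by
  refine hasProd_LSeries_of_coprime (a := fun n => (rK K (n ^ j) : ℂ))
    (by simp [rK_one]) (fun {m n} hmn => ?_) (LSeriesSummable_rK_pow hK2 hj0 hj hs)
  rw [mul_pow, rK_mul_of_coprime (hmn.pow j j), Nat.cast_mul]

theorem norm_one_sub_sq_sub_one_le {x : ℂ} (hx : ‖x‖ ≤ 1) : ‖(1 - x) ^ 2 - 1‖ ≤ 3 * ‖x‖ := by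
  have h : (1 - x) ^ 2 - 1 = x * (x - 2) := by ring
  have h2 : ‖x - 2‖ ≤ 3 := (norm_sub_le _ _).trans (by rw [Complex.norm_ofNat]; linarith)
  rw [h, norm_mul, mul_comm]
  gcongr

theorem rKLocalFactor_one_ne_zero_and_norm_inv_sub_one_le {K : Type*} [Field K]
    [NumberField K] (hK2 : Module.finrank ℚ K = 2) {p : ℕ} (hp : p.Prime) {x : ℂ}
    (hx : ‖x‖ < 1) :
    rKLocalFactor K 1 p x ≠ 0 ∧ ‖(rKLocalFactor K 1 p x)⁻¹ - 1‖ ≤ 3 * ‖x‖ := by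
  have h1 : 1 - x ≠ 0 := by
    simpa using one_sub_pow_ne_zero hx one_ne_zero
  have h2 := one_sub_pow_ne_zero hx two_ne_zero
  have hn := norm_nonneg x
  rcases isRamified_or_isSplit_or_isInert hK2 hp with h | h | h
  · rw [h.rKLocalFactor_eq hp 1 hx, inv_inv]
    refine ⟨inv_ne_zero h1, ?_⟩
    rw [sub_sub_cancel_left, norm_neg]
    linarith
  · rw [h.rKLocalFactor_eq hp 1 hx, Nat.cast_one, sub_self, zero_mul, add_zero, one_mul, inv_inv]
    exact ⟨inv_ne_zero (pow_ne_zero 2 h1), norm_one_sub_sq_sub_one_le hx.le⟩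
  · rw [h.rKLocalFactor_eq hp odd_one hx, inv_inv]
    refine ⟨inv_ne_zero h2, ?_⟩
    rw [sub_sub_cancel_left, norm_neg, norm_pow]
    nlinarith

theorem LSeries_rK_ne_zero {K : Type*} [Field K] [NumberField K]
    (hK2 : Module.finrank ℚ K = 2) {s : ℂ} (hs : 1 < s.re) :
    LSeries (fun n => (rK K n : ℂ)) s ≠ 0 := by
  have h := hasProd_rKLocalFactor hK2 one_ne_zero (by norm_num) hs
  simp only [pow_one] at h
  have hx : ∀ p : Nat.Primes, ‖((p : ℕ) : ℂ) ^ (-s)‖ < 1 := fun p =>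
    (p.2.norm_cpow_neg_le_half hs.le).trans_lt (by norm_num)
  have hu : Summable fun p : Nat.Primes => 3 * ((p : ℕ) : ℝ) ^ (-s.re) :=
    (Nat.Primes.summable_rpow.2 (by linarith)).mul_left 3
  have hm := (multipliable_and_norm_tprod_le hu fun p =>
    (rKLocalFactor_one_ne_zero_and_norm_inv_sub_one_le hK2 p.2 (hx p)).2.trans
      (mul_le_mul_of_nonneg_left (p.2.norm_cpow_neg_le le_rfl) three_pos.le)).1
  have hinv (p : Nat.Primes) : rKLocalFactor K 1 p ((p : ℂ) ^ (-s)) *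
      (rKLocalFactor K 1 p ((p : ℂ) ^ (-s)))⁻¹ = 1 :=
    mul_inv_cancel₀ (rKLocalFactor_one_ne_zero_and_norm_inv_sub_one_le hK2 p.2 (hx p)).1
  have h1 := h.mul hm.hasProd
  simp only [hinv] at h1
  exact left_ne_zero_of_mul_eq_one (h1.unique hasProd_one)

/-- The Euler product over ramified, split and inert primes whose value is `G`. -/
theorem hasProd_ramified_split_inert {K : Type*} [Field K] [NumberField K]
    {f g h : Nat.Primes → ℂ}
    (hf : Multipliable fun p : {p : Nat.Primes // (p.1 : ℤ) ∣ NumberField.discr K} => f p)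
    (hg : Multipliable fun p : {p : Nat.Primes // IsSplitPrime K p.1} => g p)
    (hh : Multipliable fun p : {p : Nat.Primes // IsInertPrime K p.1} => h p) :
    HasProd
      (fun p => {p : Nat.Primes | (p.1 : ℤ) ∣ NumberField.discr K}.mulIndicator f p *
        {p : Nat.Primes | IsSplitPrime K p.1}.mulIndicator g p *
        {p : Nat.Primes | IsInertPrime K p.1}.mulIndicator h p)
      ((∏' p : {p : Nat.Primes // (p.1 : ℤ) ∣ NumberField.discr K}, f p) *
        (∏' p : {p : Nat.Primes // IsSplitPrime K p.1}, g p) *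
        ∏' p : {p : Nat.Primes // IsInertPrime K p.1}, h p) :=
  ((hasProd_subtype_iff_mulIndicator.1 hf.hasProd).mul
    (hasProd_subtype_iff_mulIndicator.1 hg.hasProd)).mul
    (hasProd_subtype_iff_mulIndicator.1 hh.hasProd)

theorem rKLocalFactor_identity {K : Type*} [Field K] [NumberField K]
    (hK2 : Module.finrank ℚ K = 2) (p : Nat.Primes) {x : Nat.Primes → ℂ} (hx : ‖x p‖ < 1) :
    (1 - x p ^ 2)⁻¹ * rKLocalFactor K 1 p (x p ^ 2) * rKLocalFactor K 3 p (x p) =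
      rKLocalFactor K 1 p (x p) ^ 2 *
      ({p : Nat.Primes | (p.1 : ℤ) ∣ NumberField.discr K}.mulIndicator
          (fun p => ramifiedFactor (x p)) p *
        {p : Nat.Primes | IsSplitPrime K p.1}.mulIndicator (fun p => splitFactor (x p)) p *
        {p : Nat.Primes | IsInertPrime K p.1}.mulIndicator (fun p => inertFactor (x p)) p) := by
  have h1 : 1 - x p ≠ 0 := by
    simpa using one_sub_pow_ne_zero hx one_ne_zero
  have h2 := one_sub_pow_ne_zero hx two_ne_zero
  have h4 := one_sub_pow_ne_zero hx four_ne_zero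
  have hx2 : ‖x p ^ 2‖ < 1 := by
    rw [norm_pow]
    exact pow_lt_one₀ (norm_nonneg _) hx two_ne_zero
  have hR : p ∈ {p : Nat.Primes | (p.1 : ℤ) ∣ NumberField.discr K} ↔ IsRamifiedPrime K p :=
    (isRamifiedPrime_iff_dvd_discr hK2 p.2).symm
  have hS : p ∈ {p : Nat.Primes | IsSplitPrime K p.1} ↔ IsSplitPrime K p := Iff.rfl
  have hI : p ∈ {p : Nat.Primes | IsInertPrime K p.1} ↔ IsInertPrime K p := Iff.rfl
  rcases isRamified_or_isSplit_or_isInert hK2 p.2 with h | h | h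
  · rw [h.rKLocalFactor_eq p.2 1 hx, h.rKLocalFactor_eq p.2 1 hx2, h.rKLocalFactor_eq p.2 3 hx,
      Set.mulIndicator_of_mem (hR.2 h),
      Set.mulIndicator_of_notMem (hS.not.2 (not_isSplitPrime_of_isRamifiedPrime p.2 h)),
      Set.mulIndicator_of_notMem (hI.not.2 (not_isInertPrime_of_isRamifiedPrime p.2 h)),
      ramifiedFactor]
    field_simp
  · rw [h.rKLocalFactor_eq p.2 1 hx, h.rKLocalFactor_eq p.2 1 hx2, h.rKLocalFactor_eq p.2 3 hx,
      Set.mulIndicator_of_notMem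
        (hR.not.2 fun hr => not_isSplitPrime_of_isRamifiedPrime p.2 hr h),
      Set.mulIndicator_of_mem (hS.2 h),
      Set.mulIndicator_of_notMem (hI.not.2 (not_isInertPrime_of_isSplitPrime p.2 h)), splitFactor]
    push_cast
    field_simp
    ring
  · rw [h.rKLocalFactor_eq p.2 odd_one hx, h.rKLocalFactor_eq p.2 odd_one hx2,
      h.rKLocalFactor_eq p.2 (by decide) hx,
      Set.mulIndicator_of_notMem
        (hR.not.2 fun hr => not_isInertPrime_of_isRamifiedPrime p.2 hr h),
      Set.mulIndicator_of_notMem (hS.not.2 fun hs => not_isInertPrime_of_isSplitPrime p.2 hs h),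
      Set.mulIndicator_of_mem (hI.2 h), inertFactor, ← pow_mul]
    field_simp

/-- For a quadratic number field `K` of discriminant `D` and `Re s > 1`,
`∑_{n ≥ 1} r_K(n³) n^{-s} = (ζ_K(s)² / (ζ(2s) ζ_K(2s))) G(s)` with
`G(s) = ∏_{p∣D} (1−p^{-s})(1−p^{-2s})^{-2} ∏_{p split} (1+2p^{-s})(1−p^{-s})²(1−p^{-2s})^{-3}
∏_{p inert} (1−p^{-4s})^{-1}`, where `ζ_K` is given on `Re s > 1` by
`ζ_K(s) = ∑_{n ≥ 1} r_K(n) n^{-s}`; moreover `G` is holomorphic and bounded on every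
half-plane `Re s ≥ θ` with `θ > 1/3`. -/
theorem rK_cubes_dirichlet_series
    (K : Type) [Field K] [NumberField K] (hK2 : Module.finrank ℚ K = 2)
    (G : ℂ → ℂ)
    (hG : ∀ s : ℂ, G s =
      (∏' p : {p : Nat.Primes // (p.1 : ℤ) ∣ NumberField.discr K},
        (1 - (p.1.1 : ℂ) ^ (-s)) * ((1 - (p.1.1 : ℂ) ^ (-(2 * s))) ^ 2)⁻¹) *
      (∏' p : {p : Nat.Primes // IsSplitPrime K p.1},
        (1 + 2 * (p.1.1 : ℂ) ^ (-s)) * (1 - (p.1.1 : ℂ) ^ (-s)) ^ 2 *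
          ((1 - (p.1.1 : ℂ) ^ (-(2 * s))) ^ 3)⁻¹) *
      (∏' p : {p : Nat.Primes // IsInertPrime K p.1},
        (1 - (p.1.1 : ℂ) ^ (-(4 * s)))⁻¹)) :
    (∀ s : ℂ, 1 < s.re →
      LSeries (fun n => (rK K (n ^ 3) : ℂ)) s =
        (LSeries (fun n => (rK K n : ℂ)) s) ^ 2 /
          (riemannZeta (2 * s) * LSeries (fun n => (rK K n : ℂ)) (2 * s)) * G s) ∧
    (∀ θ : ℝ, 1 / 3 < θ →
      (∀ s : ℂ, θ ≤ s.re → DifferentiableAt ℂ G s) ∧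
      ∃ M : ℝ, ∀ s : ℂ, θ ≤ s.re → ‖G s‖ ≤ M) := by
  have hG' : G = fun s =>
      (∏' p : {p : Nat.Primes // (p.1 : ℤ) ∣ NumberField.discr K},
        ramifiedFactor ((p.1.1 : ℂ) ^ (-s))) *
      (∏' p : {p : Nat.Primes // IsSplitPrime K p.1}, splitFactor ((p.1.1 : ℂ) ^ (-s))) *
      ∏' p : {p : Nat.Primes // IsInertPrime K p.1}, inertFactor ((p.1.1 : ℂ) ^ (-s)) := by
    funext s
    have h2 (p : ℕ) : (p : ℂ) ^ (-(2 * s)) = ((p : ℂ) ^ (-s)) ^ 2 := by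
      exact_mod_cast Complex.natCast_cpow_neg_natCast_mul p 2 s
    have h4 (p : ℕ) : (p : ℂ) ^ (-(4 * s)) = ((p : ℂ) ^ (-s)) ^ 4 := by
      exact_mod_cast Complex.natCast_cpow_neg_natCast_mul p 4 s
    simp only [hG, h2, h4, ramifiedFactor, splitFactor, inertFactor]
  subst hG'
  have hR (θ : ℝ) (hθ : 1 / 3 < θ) :=
    eulerProduct_ramifiedFactor (NumberField.discr_ne_zero K) hθ.le
  have hS (θ : ℝ) (hθ : 1 / 3 < θ) := eulerProduct_of_norm_sub_one_le_pow_three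
    (P := fun p => IsSplitPrime K p.1) hθ (by norm_num)
    (fun _ => differentiableAt_splitFactor) fun _ => norm_splitFactor_sub_one_le
  have hI (θ : ℝ) (hθ : 1 / 3 < θ) := eulerProduct_of_norm_sub_one_le_pow_three
    (P := fun p => IsInertPrime K p.1) hθ (by norm_num)
    (fun _ => differentiableAt_inertFactor) fun _ => norm_inertFactor_sub_one_le
  refine ⟨fun s hs => ?_, fun θ hθ => ?_⟩
  · have hs2 : 1 < (2 * s).re := by
      simp only [Complex.mul_re, Complex.re_ofNat, Complex.im_ofNat]
      linarith
    have h2 (p : ℕ) : (p : ℂ) ^ (-(2 * s)) = ((p : ℂ) ^ (-s)) ^ 2 := by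
      exact_mod_cast Complex.natCast_cpow_neg_natCast_mul p 2 s
    have hZ := hasProd_rKLocalFactor hK2 one_ne_zero (by norm_num) hs
    have hZ2 := hasProd_rKLocalFactor hK2 one_ne_zero (by norm_num) hs2
    have hA := hasProd_rKLocalFactor hK2 three_ne_zero le_rfl hs
    have hζ := riemannZeta_eulerProduct_hasProd hs2
    simp only [h2, pow_one] at hZ hZ2 hζ
    have hGp := hasProd_ramified_split_inert (K := K)
      (f := fun p => ramifiedFactor ((p : ℂ) ^ (-s))) (g := fun p => splitFactor ((p : ℂ) ^ (-s)))
      (h := fun p => inertFactor ((p : ℂ) ^ (-s))) ((hR 1 (by norm_num)).1 s hs)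
      ((hS 1 (by norm_num)).1 s hs) ((hI 1 (by norm_num)).1 s hs)
    have hleft := (hζ.mul hZ2).mul hA
    have hid (p : Nat.Primes) := rKLocalFactor_identity hK2 p
      (x := fun p : Nat.Primes => (p : ℂ) ^ (-s))
      ((p.2.norm_cpow_neg_le_half hs.le).trans_lt (by norm_num))
    have heq := hleft.unique (((hZ.pow 2).mul hGp).congr_fun hid)
    rw [div_mul_eq_mul_div, eq_div_iff
      (mul_ne_zero (riemannZeta_ne_zero_of_one_lt_re hs2) (LSeries_rK_ne_zero hK2 hs2)), ← heq]
    ring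
  · obtain ⟨θ', hθ', hlt⟩ := exists_between hθ
    obtain ⟨-, ⟨M₁, h₁⟩, d₁⟩ := hR θ' hθ'
    obtain ⟨-, ⟨M₂, h₂⟩, d₂⟩ := hS θ' hθ'
    obtain ⟨-, ⟨M₃, h₃⟩, d₃⟩ := hI θ' hθ'
    refine ⟨fun s hs => ((d₁.mul d₂).mul d₃).differentiableAt
      ((isOpen_lt continuous_const Complex.continuous_re).mem_nhds (hlt.trans_le hs)),
      M₁ * M₂ * M₃, fun s hs => ?_⟩
    have hs' : θ' < s.re := hlt.trans_le hs
    rw [norm_mul, norm_mul]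
    have hM₁ := (norm_nonneg _).trans (h₁ s hs')
    have hM₂ := (norm_nonneg _).trans (h₂ s hs')
    gcongr
    · exact h₁ s hs'
    · exact h₂ s hs'
    · exact h₃ s hs'
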